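/- arXiv:1710.00525 — 4 statements merged into one kernel-verified Lean document; each statement's English description precedes it below -/
import Mathlib

section
/- Let a and b be relatively prime positive integers and n a positive integer. If n − 3 is not an integer multiple of gcd(4, a), then β_j ≠ τ_k for every positive integer j and every integer k, and consequently |β_j − τ_k| ≥ π/(4b) for every such j and k. -/
/-- For relatively prime positive integers `a`, `b` and a positive integer `n`,
with `β_j = (4j + n - 3)π/4` and `τ_k = |k|·a·π/(4b)`, if `n - 3` is not an integer
multiple of `gcd(4, a)`, then `β_j ≠ τ_k` for every positive integer `j` and integer `k`,
and moreover `|β_j - τ_k| ≥ π/(4b)` for all such `j`, `k`. -/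
theorem stmt_1 (a b n : ℕ) (ha : 0 < a) (hb : 0 < b) (hn : 0 < n)
    (hab : Nat.Coprime a b) (hnd : ¬ ((Nat.gcd 4 a : ℤ) ∣ ((n : ℤ) - 3))) :
    ∀ j : ℕ, 0 < j → ∀ k : ℤ,
      ((4 * j + n : ℝ) - 3) * Real.pi / 4 ≠ |(k : ℝ)| * a * Real.pi / (4 * b) ∧
      Real.pi / (4 * b) ≤
        |((4 * j + n : ℝ) - 3) * Real.pi / 4 - |(k : ℝ)| * a * Real.pi / (4 * b)| := by
  intro j _ k
  have hM : (b : ℤ) * (4 * j + n - 3) - |k| * a ≠ 0 := by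
    intro h
    apply hnd
    have hga : ((Nat.gcd 4 a : ℕ) : ℤ) ∣ (a : ℤ) :=
      Int.natCast_dvd_natCast.mpr (Nat.gcd_dvd_right 4 a)
    have hg4 : ((Nat.gcd 4 a : ℕ) : ℤ) ∣ (4 : ℤ) := by
      exact_mod_cast Int.natCast_dvd_natCast.mpr (Nat.gcd_dvd_left 4 a)
    have hcop : IsCoprime ((Nat.gcd 4 a : ℕ) : ℤ) (b : ℤ) :=
      Nat.isCoprime_iff_coprime.mpr (Nat.Coprime.coprime_dvd_left (Nat.gcd_dvd_right 4 a) hab)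
    have h1 : ((Nat.gcd 4 a : ℕ) : ℤ) ∣ (b : ℤ) * (4 * j + n - 3) := by
      rw [sub_eq_zero.mp h]
      exact Dvd.dvd.mul_left hga _
    have h2 := hcop.dvd_of_dvd_mul_left h1
    have h3 := dvd_sub h2 (Dvd.dvd.mul_right hg4 (j : ℤ))
    have h4 : (4 * j + n - 3 : ℤ) - 4 * j = n - 3 := by ring
    rwa [h4] at h3
  have hb' : (0 : ℝ) < b := by exact_mod_cast hb
  have hpos : 0 < Real.pi / (4 * b) := by positivity
  have key : ((4 * j + n : ℝ) - 3) * Real.pi / 4 - |(k : ℝ)| * a * Real.pi / (4 * b)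
      = (((b : ℤ) * (4 * j + n - 3) - |k| * a : ℤ) : ℝ) * (Real.pi / (4 * b)) := by
    push_cast
    field_simp
  have hle : Real.pi / (4 * b) ≤
      |((4 * j + n : ℝ) - 3) * Real.pi / 4 - |(k : ℝ)| * a * Real.pi / (4 * b)| := by
    rw [key, abs_mul, abs_of_pos hpos]
    have : (1 : ℝ) ≤ |(((b : ℤ) * (4 * j + n - 3) - |k| * a : ℤ) : ℝ)| := by
      exact_mod_cast Int.one_le_abs hM
    exact le_mul_of_one_le_left hpos.le this
  refine ⟨fun h => ?_, hle⟩
  rw [h, sub_self, abs_zero] at hle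
  linarith
end

section
/- Let a and b be relatively prime positive integers and n a positive integer. If n − 3 is an integer multiple of gcd(4, a), then there exist infinitely many pairs (j, k), with j a positive integer and k a nonnegative integer, such that β_j = τ_k. -/
/-- For relatively prime positive integers `a`, `b` and a positive integer `n`,
with `β_j = (4j + n - 3)π/4` and `τ_k = k·a·π/(4b)` (for nonnegative `k`),
if `n - 3` is an integer multiple of `gcd(4, a)`, then there are infinitely many pairs
`(j, k)` with `j` a positive integer and `k` a nonnegative integer such that `β_j = τ_k`. -/
theorem stmt_2 (a b n : ℕ) (ha : 0 < a) (hb : 0 < b) (hn : 0 < n)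
    (hab : Nat.Coprime a b) (hd : (Nat.gcd 4 a : ℤ) ∣ ((n : ℤ) - 3)) :
    {p : ℕ × ℕ | 0 < p.1 ∧
      ((4 * p.1 + n : ℝ) - 3) * Real.pi / 4 = (p.2 : ℝ) * a * Real.pi / (4 * b)}.Infinite := by
  obtain ⟨c, hc⟩ := hd
  have hbez := Nat.gcd_eq_gcd_ab 4 a
  generalize Nat.gcdA 4 a = x at hbez
  generalize Nat.gcdB 4 a = y at hbez
  rw [hbez] at hc
  push_cast at hc
  have key : ∀ m : ℕ, ∃ p : ℕ × ℕ,
      (p.1 : ℤ) = -(x * c) + a * (|x * c| + |y * c| + 1 + m) ∧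
      (p.2 : ℤ) = b * (y * c + 4 * (|x * c| + |y * c| + 1 + m)) ∧ 0 < p.1 := by
    intro m
    have h1 := le_abs_self (x * c)
    have h2 := neg_abs_le (y * c)
    have h3 := abs_nonneg (x * c)
    have h4 := abs_nonneg (y * c)
    have ha' : (1 : ℤ) ≤ a := by exact_mod_cast ha
    have hm : (0 : ℤ) ≤ m := by positivity
    have hj : 0 < -(x * c) + a * (|x * c| + |y * c| + 1 + m) := by
      have : 1 * (|x * c| + |y * c| + 1 + (m : ℤ)) ≤ a * (|x * c| + |y * c| + 1 + m) :=
        mul_le_mul_of_nonneg_right ha' (by linarith)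
      linarith
    have hk : 0 ≤ (b : ℤ) * (y * c + 4 * (|x * c| + |y * c| + 1 + m)) :=
      mul_nonneg (by positivity) (by linarith)
    refine ⟨(Int.toNat _, Int.toNat _), Int.toNat_of_nonneg hj.le, Int.toNat_of_nonneg hk, ?_⟩
    simpa using hj
  choose f hf1 hf2 hf3 using key
  refine Set.infinite_of_injective_forall_mem (f := f) ?_ ?_
  · intro m m' h
    have e1 := hf1 m
    rw [h, hf1 m'] at e1
    have ha' : (a : ℤ) ≠ 0 := by exact_mod_cast ha.ne'
    have := mul_left_cancel₀ ha' (add_left_cancel e1)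
    have h' : (m' : ℤ) = m := by linarith
    exact_mod_cast h'.symm
  · intro m
    refine ⟨hf3 m, ?_⟩
    have e : (4 * ((f m).1 : ℤ) + n - 3) * b = (f m).2 * a := by
      rw [hf1, hf2]
      linear_combination (b : ℤ) * hc
    have e' : (4 * ((f m).1 : ℝ) + n - 3) * b = (f m).2 * a := by exact_mod_cast e
    have hb' : (b : ℝ) ≠ 0 := by exact_mod_cast hb.ne'
    rw [div_eq_div_iff (by norm_num) (by positivity)]
    linear_combination 4 * Real.pi * e'
end

section
/- Under the stated hypotheses on H, H₁, H₂, H₃, Φ, γ and h, if Φ satisfies the Palais–Smale condition (PS)_c at a level c ∈ ℝ, then the reduced functional Φ̂(u) = Φ(u + h(u)) also satisfies the (PS)_c condition on H₂. -/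
open scoped RealInnerProductSpace

/-- A `C¹` functional `Ψ` on a normed space `K` satisfies the Palais–Smale condition at
level `c` if every sequence `(xₙ)` with `Ψ(xₙ) → c` and `Ψ'(xₙ) → 0` (equivalently
`∇Ψ(xₙ) → 0`) has a convergent subsequence. -/
def PalaisSmaleCond {K : Type*} [NormedAddCommGroup K] [NormedSpace ℝ K]
    (Ψ : K → ℝ) (c : ℝ) : Prop :=
  ∀ x : ℕ → K,
    Filter.Tendsto (fun n => Ψ (x n)) Filter.atTop (nhds c) →
    Filter.Tendsto (fun n => fderiv ℝ Ψ (x n)) Filter.atTop (nhds 0) →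
    ∃ φ : ℕ → ℕ, StrictMono φ ∧ ∃ y : K,
      Filter.Tendsto (fun n => x (φ n)) Filter.atTop (nhds y)

open Filter Topology

lemma aux_quad {H : Type*} [NormedAddCommGroup H] [InnerProductSpace ℝ H]
    (Φ : H → ℝ) (hd : Differentiable ℝ Φ) (γ : ℝ) (b d : H)
    (hm : ∀ t : ℝ, γ * ‖t • d‖ ^ 2 ≤ fderiv ℝ Φ (b + t • d) (t • d) - fderiv ℝ Φ b (t • d)) :
    Φ b + fderiv ℝ Φ b d + γ / 2 * ‖d‖ ^ 2 ≤ Φ (b + d) := by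
  have key : ∀ t : ℝ, HasDerivAt
      (fun t : ℝ => Φ (b + t • d) - t * fderiv ℝ Φ b d - γ / 2 * ‖d‖ ^ 2 * t ^ 2)
      (fderiv ℝ Φ (b + t • d) d - fderiv ℝ Φ b d - γ * ‖d‖ ^ 2 * t) t := by
    intro t
    have h1 : HasDerivAt (fun t : ℝ => b + t • d) d t := by
      simpa using ((hasDerivAt_id t).smul_const d).const_add b
    have h2 := (hd (b + t • d)).hasFDerivAt.comp_hasDerivAt t h1
    have h3 := (h2.sub ((hasDerivAt_id t).mul_const (fderiv ℝ Φ b d))).sub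
      (((hasDerivAt_id t).pow 2).const_mul (γ / 2 * ‖d‖ ^ 2))
    refine h3.congr_deriv ?_
    simp only [id, Nat.cast_ofNat]
    ring
  have mono : MonotoneOn
      (fun t : ℝ => Φ (b + t • d) - t * fderiv ℝ Φ b d - γ / 2 * ‖d‖ ^ 2 * t ^ 2)
      (Set.Icc 0 1) := by
    apply monotoneOn_of_deriv_nonneg (convex_Icc 0 1)
    · exact fun t _ => (key t).continuousAt.continuousWithinAt
    · exact fun t _ => (key t).differentiableAt.differentiableWithinAt
    · intro t ht
      rw [interior_Icc] at ht
      rw [(key t).deriv]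
      have h1 := hm t
      rw [norm_smul, map_smul, map_smul, mul_pow, Real.norm_eq_abs, sq_abs, smul_eq_mul,
        smul_eq_mul] at h1
      have : 0 ≤ t * (fderiv ℝ Φ (b + t • d) d - fderiv ℝ Φ b d - γ * ‖d‖ ^ 2 * t) := by
        nlinarith
      exact nonneg_of_mul_nonneg_right this ht.1
  have := mono (Set.left_mem_Icc.2 zero_le_one) (Set.right_mem_Icc.2 zero_le_one) zero_le_one
  simp at this
  linarith

lemma aux_exist {K ι : Type*} [NormedAddCommGroup K] [NormedSpace ℝ K] [CompleteSpace K]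
    (F : K → ι → ℝ) (hF : ∀ i, Continuous fun a => F a i) (δ S : ℝ) (hδ : 0 < δ)
    (hmid : ∀ a b i, F ((1 / 2 : ℝ) • (a + b)) i ≤ (F a i + F b i) / 2 - δ * ‖a - b‖ ^ 2)
    (hup : ∀ ε > 0, ∃ a, ∀ i, F a i ≤ S + ε)
    (hlow : ∀ a, ∀ ε > 0, ∃ i, S - ε ≤ F a i) : ∃ a, ∀ i, F a i ≤ S := by
  choose a ha using fun n : ℕ => hup (1 / ((n : ℝ) + 1)) (by positivity)
  have hdist : ∀ n m N : ℕ, N ≤ n → N ≤ m → δ * ‖a n - a m‖ ^ 2 ≤ 1 / ((N : ℝ) + 1) := by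
    intro n m N hn hm
    apply le_of_forall_pos_le_add
    intro ε hε
    obtain ⟨i, hi⟩ := hlow ((1 / 2 : ℝ) • (a n + a m)) ε hε
    have h1 := hmid (a n) (a m) i
    have h2 := ha n i
    have h3 := ha m i
    have h4 : 1 / ((n : ℝ) + 1) ≤ 1 / ((N : ℝ) + 1) := one_div_le_one_div_of_le
      (by positivity) (by exact_mod_cast Nat.succ_le_succ hn)
    have h5 : 1 / ((m : ℝ) + 1) ≤ 1 / ((N : ℝ) + 1) := one_div_le_one_div_of_le
      (by positivity) (by exact_mod_cast Nat.succ_le_succ hm)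
    linarith
  have hlim : Tendsto (fun n : ℕ => 1 / ((n : ℝ) + 1)) atTop (𝓝 0) :=
    tendsto_one_div_add_atTop_nhds_zero_nat
  have hc : CauchySeq a := by
    rw [Metric.cauchySeq_iff]
    intro ε hε
    obtain ⟨N, hN⟩ := (hlim.eventually (gt_mem_nhds (show 0 < δ * ε ^ 2 by positivity))).exists
    refine ⟨N, fun n hn m hm => ?_⟩
    have := (hdist n m N hn hm).trans_lt hN
    rw [dist_eq_norm]
    have h2 := lt_of_mul_lt_mul_left this hδ.le
    exact lt_of_pow_lt_pow_left₀ 2 hε.le h2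
  obtain ⟨x, hx⟩ := cauchySeq_tendsto_of_complete hc
  refine ⟨x, fun i => ?_⟩
  have h1 : Tendsto (fun n => F (a n) i) atTop (𝓝 (F x i)) := ((hF i).tendsto x).comp hx
  have h2 : Tendsto (fun n : ℕ => S + 1 / ((n : ℝ) + 1)) atTop (𝓝 S) := by
    simpa using hlim.const_add S
  exact le_of_tendsto_of_tendsto' h1 h2 fun n => ha n i

lemma aux_mid {H : Type*} [NormedAddCommGroup H] [InnerProductSpace ℝ H]
    (Φ : H → ℝ) (γ : ℝ) (K : Submodule ℝ H)
    (hq : ∀ b, ∀ d ∈ K, Φ b + fderiv ℝ Φ b d + γ / 2 * ‖d‖ ^ 2 ≤ Φ (b + d))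
    (p a b : H) (ha : a ∈ K) (hb : b ∈ K) :
    Φ (p + (1 / 2 : ℝ) • (a + b)) ≤ (Φ (p + a) + Φ (p + b)) / 2 - γ / 8 * ‖a - b‖ ^ 2 := by
  have hd : (1 / 2 : ℝ) • (a - b) ∈ K := K.smul_mem _ (K.sub_mem ha hb)
  have h1 := hq (p + (1 / 2 : ℝ) • (a + b)) _ hd
  have h2 := hq (p + (1 / 2 : ℝ) • (a + b)) _ (K.neg_mem hd)
  have e1 : p + (1 / 2 : ℝ) • (a + b) + (1 / 2 : ℝ) • (a - b) = p + a := by module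
  have e2 : p + (1 / 2 : ℝ) • (a + b) + -((1 / 2 : ℝ) • (a - b)) = p + b := by module
  rw [e1] at h1
  rw [e2, map_neg, norm_neg] at h2
  have e3 : ‖(1 / 2 : ℝ) • (a - b)‖ ^ 2 = 1 / 4 * ‖a - b‖ ^ 2 := by
    rw [norm_smul, mul_pow]
    norm_num
  rw [e3] at h1 h2
  linarith

lemma aux_bdd {H : Type*} [NormedAddCommGroup H] [InnerProductSpace ℝ H]
    (Φ : H → ℝ) (γ : ℝ) (hγ : 0 < γ) (K : Submodule ℝ H)
    (hq : ∀ b, ∀ d ∈ K, Φ b + fderiv ℝ Φ b d + γ / 2 * ‖d‖ ^ 2 ≤ Φ (b + d))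
    (p : H) : ∃ C : ℝ, ∀ d ∈ K, C ≤ Φ (p + d) := by
  refine ⟨Φ p - ‖fderiv ℝ Φ p‖ ^ 2 / (2 * γ), fun d hd => ?_⟩
  have h1 := hq p d hd
  have h2 : -(‖fderiv ℝ Φ p‖ * ‖d‖) ≤ fderiv ℝ Φ p d :=
    (abs_le.1 ((Real.norm_eq_abs _).symm.le.trans ((fderiv ℝ Φ p).le_opNorm d))).1
  have h3 : ‖fderiv ℝ Φ p‖ * ‖d‖ ≤ ‖fderiv ℝ Φ p‖ ^ 2 / (2 * γ) + γ / 2 * ‖d‖ ^ 2 := by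
    have : ‖fderiv ℝ Φ p‖ ^ 2 / (2 * γ) + γ / 2 * ‖d‖ ^ 2 - ‖fderiv ℝ Φ p‖ * ‖d‖
        = (‖fderiv ℝ Φ p‖ - γ * ‖d‖) ^ 2 / (2 * γ) := by
      field_simp
      ring
    have h4 : 0 ≤ (‖fderiv ℝ Φ p‖ - γ * ‖d‖) ^ 2 / (2 * γ) := by positivity
    linarith
  linarith

lemma aux_crit {H : Type*} [NormedAddCommGroup H] [InnerProductSpace ℝ H]
    (Φ : H → ℝ) (hd : Differentiable ℝ Φ) (K : Submodule ℝ H) (x : H)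
    (hx : ∀ d ∈ K, Φ x ≤ Φ (x + d)) : ∀ d ∈ K, fderiv ℝ Φ x d = 0 := by
  intro d hdK
  have h1 : HasDerivAt (fun t : ℝ => x + t • d) d 0 := by
    simpa using ((hasDerivAt_id (0 : ℝ)).smul_const d).const_add x
  have h2 : HasFDerivAt Φ (fderiv ℝ Φ x) (x + (0 : ℝ) • d) := by
    simpa using (hd x).hasFDerivAt
  have h3 := h2.comp_hasDerivAt (0 : ℝ) h1
  refine IsLocalMin.hasDerivAt_eq_zero (f := Φ ∘ fun t : ℝ => x + t • d) (a := 0) ?_ h3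
  refine Eventually.of_forall fun t => ?_
  simpa using hx (t • d) (K.smul_mem _ hdK)

/-- Abstract saddle: existence from the minimax equality. -/
lemma aux_saddle {H : Type*} [NormedAddCommGroup H] [InnerProductSpace ℝ H] [CompleteSpace H]
    (H₁ H₃ : Submodule ℝ H) (hc₁ : IsClosed (H₁ : Set H)) (hc₃ : IsClosed (H₃ : Set H))
    (Φ : H → ℝ) (hΦ : Continuous Φ) (γ : ℝ) (hγ : 0 < γ)
    (hq₃ : ∀ b, ∀ d ∈ H₃, Φ b + fderiv ℝ Φ b d + γ / 2 * ‖d‖ ^ 2 ≤ Φ (b + d))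
    (hq₁ : ∀ b, ∀ d ∈ H₁, -Φ b + fderiv ℝ (fun x => -Φ x) b d + γ / 2 * ‖d‖ ^ 2 ≤ -Φ (b + d))
    (u : H) (S : ℝ) (hS₁ : S = ⨆ v : H₁, ⨅ w : H₃, Φ (u + ↑v + ↑w))
    (hS₃ : S = ⨅ w : H₃, ⨆ v : H₁, Φ (u + ↑v + ↑w)) :
    ∃ v ∈ H₁, ∃ w ∈ H₃, (∀ v' ∈ H₁, Φ (u + v' + w) ≤ S) ∧ ∀ w' ∈ H₃, S ≤ Φ (u + v + w') := by
  have : CompleteSpace H₁ := hc₁.completeSpace_coe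
  have : CompleteSpace H₃ := hc₃.completeSpace_coe
  have bb : ∀ v : H₁, BddBelow (Set.range fun w : H₃ => Φ (u + ↑v + ↑w)) := by
    intro v
    obtain ⟨C, hC⟩ := aux_bdd Φ γ hγ H₃ hq₃ (u + v)
    exact ⟨C, by rintro _ ⟨w, rfl⟩; exact hC w w.2⟩
  have ba : ∀ w : H₃, BddAbove (Set.range fun v : H₁ => Φ (u + ↑v + ↑w)) := by
    intro w
    obtain ⟨C, hC⟩ := aux_bdd (fun x => -Φ x) γ hγ H₁ hq₁ (u + w)
    refine ⟨-C, ?_⟩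
    rintro _ ⟨v, rfl⟩
    have := hC v v.2
    rw [add_right_comm] at this
    simp only
    linarith
  have bb' : BddBelow (Set.range fun w : H₃ => ⨆ v : H₁, Φ (u + ↑v + ↑w)) := by
    obtain ⟨C, hC⟩ := bb 0
    refine ⟨C, ?_⟩
    rintro _ ⟨w, rfl⟩
    exact (hC ⟨w, rfl⟩).trans (le_ciSup (ba w) 0)
  have ba' : BddAbove (Set.range fun v : H₁ => ⨅ w : H₃, Φ (u + ↑v + ↑w)) := by
    obtain ⟨C, hC⟩ := ba 0
    refine ⟨C, ?_⟩
    rintro _ ⟨v, rfl⟩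
    exact (ciInf_le (bb v) 0).trans (hC ⟨v, rfl⟩)
  obtain ⟨w, hw⟩ := aux_exist (fun (w : H₃) (v : H₁) => Φ (u + ↑v + ↑w))
    (fun v => by fun_prop) (γ / 8) S (by positivity)
    (fun a b v => aux_mid Φ γ H₃ hq₃ (u + v) a b a.2 b.2)
    (by
      intro ε hε
      obtain ⟨w, hw⟩ := exists_lt_of_ciInf_lt (show (⨅ w : H₃, ⨆ v : H₁, Φ (u + ↑v + ↑w)) < S + ε
        by linarith)
      exact ⟨w, fun v => (le_ciSup (ba w) v).trans hw.le⟩)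
    (by
      intro w ε hε
      have h1 : S ≤ ⨆ v : H₁, Φ (u + ↑v + ↑w) := hS₃.le.trans (ciInf_le bb' w)
      obtain ⟨v, hv⟩ := exists_lt_of_lt_ciSup (show S - ε < ⨆ v : H₁, Φ (u + ↑v + ↑w)
        by linarith)
      exact ⟨v, hv.le⟩)
  obtain ⟨v, hv⟩ := aux_exist (fun (v : H₁) (w : H₃) => -Φ (u + ↑v + ↑w))
    (fun w => by fun_prop) (γ / 8) (-S) (by positivity)
    (fun a b w => by
      have := aux_mid (fun x => -Φ x) γ H₁ hq₁ (u + w) a b a.2 b.2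
      simp only [add_right_comm u (w : H)] at this
      exact this)
    (by
      intro ε hε
      obtain ⟨v, hv⟩ := exists_lt_of_lt_ciSup (show S - ε < (⨆ v : H₁, ⨅ w : H₃, Φ (u + ↑v + ↑w))
        by linarith)
      refine ⟨v, fun w => ?_⟩
      have := hv.trans_le (ciInf_le (bb v) w)
      linarith)
    (by
      intro v ε hε
      have h1 : ⨅ w : H₃, Φ (u + ↑v + ↑w) ≤ S := (le_ciSup ba' v).trans hS₁.ge
      obtain ⟨w, hw⟩ := exists_lt_of_ciInf_lt (show ⨅ w : H₃, Φ (u + ↑v + ↑w) < S + ε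
        by linarith)
      exact ⟨w, by linarith⟩)
  exact ⟨v, v.2, w, w.2, fun v' hv' => hw ⟨v', hv'⟩, fun w' hw' => neg_le_neg_iff.1 (hv ⟨w', hw'⟩)⟩

/-- Saddle point reduction, part (iv): if `Φ` satisfies the Palais–Smale condition `(PS)_c`
at level `c`, then the reduced functional `Φ̂(u) = Φ(u + h(u))` also satisfies the `(PS)_c`
condition on `H₂`. -/
theorem stmt_9 {H : Type*} [NormedAddCommGroup H] [InnerProductSpace ℝ H] [CompleteSpace H]
    (H₁ H₂ H₃ : Submodule ℝ H)
    (hc₁ : IsClosed (H₁ : Set H)) (hc₂ : IsClosed (H₂ : Set H)) (hc₃ : IsClosed (H₃ : Set H))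
    (ho₁₂ : H₁ ⟂ H₂) (ho₁₃ : H₁ ⟂ H₃) (ho₂₃ : H₂ ⟂ H₃)
    (hspan : H₁ ⊔ H₂ ⊔ H₃ = ⊤)
    (Φ : H → ℝ) (hΦ : ContDiff ℝ 1 Φ) (γ : ℝ) (hγ : 0 < γ)
    (hm₁ : ∀ u ∈ H₂, ∀ w ∈ H₃, ∀ v₁ ∈ H₁, ∀ v₂ ∈ H₁,
      ⟪gradient Φ (u + w + v₁) - gradient Φ (u + w + v₂), v₁ - v₂⟫ ≤ -γ * ‖v₁ - v₂‖ ^ 2)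
    (hm₂ : ∀ u ∈ H₂, ∀ v ∈ H₁, ∀ w₁ ∈ H₃, ∀ w₂ ∈ H₃,
      γ * ‖w₁ - w₂‖ ^ 2 ≤ ⟪gradient Φ (u + w₁ + v) - gradient Φ (u + w₂ + v), w₁ - w₂⟫)
    (h : H₂ → H) (hh_cont : Continuous h) (hh_mem : ∀ u : H₂, h u ∈ H₁ ⊔ H₃)
    (hh_eq : ∀ u : H₂,
      Φ (↑u + h u) = (⨆ v : H₁, ⨅ w : H₃, Φ (↑u + ↑v + ↑w)) ∧
      Φ (↑u + h u) = (⨅ w : H₃, ⨆ v : H₁, Φ (↑u + ↑v + ↑w)))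
    (Φhat : H₂ → ℝ) (hΦhat : ∀ u : H₂, Φhat u = Φ (↑u + h u))
    (c : ℝ) (hPS : PalaisSmaleCond Φ c) :
    PalaisSmaleCond Φhat c := by
  classical
  have hd : Differentiable ℝ Φ := hΦ.differentiable one_ne_zero
  have hgrad : ∀ x y, ⟪gradient Φ x, y⟫ = fderiv ℝ Φ x y := fun x y => by
    simp [gradient]
  have hdec : ∀ x : H, ∃ v ∈ H₁, ∃ u ∈ H₂, ∃ w ∈ H₃, v + u + w = x := by
    intro x
    have hx : x ∈ H₁ ⊔ H₂ ⊔ H₃ := hspan ▸ Submodule.mem_top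
    obtain ⟨y, hy, w, hw, rfl⟩ := Submodule.mem_sup.1 hx
    obtain ⟨v, hv, u, hu, rfl⟩ := Submodule.mem_sup.1 hy
    exact ⟨v, hv, u, hu, w, hw, rfl⟩
  have hq₃ : ∀ b, ∀ d ∈ H₃, Φ b + fderiv ℝ Φ b d + γ / 2 * ‖d‖ ^ 2 ≤ Φ (b + d) := by
    intro b d hdd
    apply aux_quad Φ hd
    intro t
    obtain ⟨v, hv, u, hu, w, hw, rfl⟩ := hdec b
    have := hm₂ u hu v hv (w + t • d) (H₃.add_mem hw (H₃.smul_mem t hdd)) w hw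
    rw [inner_sub_left, hgrad, hgrad, add_sub_cancel_left] at this
    rwa [show v + u + w + t • d = u + (w + t • d) + v by abel, show v + u + w = u + w + v by abel]
  have hfn : ∀ x, fderiv ℝ (fun x => -Φ x) x = -fderiv ℝ Φ x := fun x => fderiv_fun_neg
  have hq₁ : ∀ b, ∀ d ∈ H₁,
      -Φ b + fderiv ℝ (fun x => -Φ x) b d + γ / 2 * ‖d‖ ^ 2 ≤ -Φ (b + d) := by
    intro b d hdd
    apply aux_quad (fun x => -Φ x) hd.neg
    intro t
    obtain ⟨v, hv, u, hu, w, hw, rfl⟩ := hdec b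
    have := hm₁ u hu w hw (v + t • d) (H₁.add_mem hv (H₁.smul_mem t hdd)) v hv
    rw [inner_sub_left, hgrad, hgrad, add_sub_cancel_left] at this
    rw [hfn, hfn, show v + u + w + t • d = u + w + (v + t • d) by abel,
      show v + u + w = u + w + v by abel]
    simp only [_root_.neg_apply]
    linarith
  have hsad : ∀ u : H₂, ∃ v ∈ H₁, ∃ w ∈ H₃, (∀ v' ∈ H₁, Φ (u + v' + w) ≤ Φhat u) ∧
      ∀ w' ∈ H₃, Φhat u ≤ Φ (u + v + w') := fun u =>
    aux_saddle H₁ H₃ hc₁ hc₃ Φ hΦ.continuous γ hγ hq₃ hq₁ u (Φhat u)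
      ((hΦhat u).trans (hh_eq u).1) ((hΦhat u).trans (hh_eq u).2)
  choose V hV W hW hle hge using hsad
  have hval : ∀ u : H₂, Φhat u = Φ (u + V u + W u) := fun u =>
    le_antisymm (hge u _ (hW u)) (hle u _ (hV u))
  have hcr₃ : ∀ u : H₂, ∀ d ∈ H₃, fderiv ℝ Φ (u + V u + W u) d = 0 := by
    intro u
    apply aux_crit Φ hd
    intro d hdd
    rw [← hval, add_assoc]
    exact hge u _ (H₃.add_mem (hW u) hdd)
  have hcr₁ : ∀ u : H₂, ∀ d ∈ H₁, fderiv ℝ Φ (u + V u + W u) d = 0 := by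
    intro u d hdd
    have := aux_crit (fun x => -Φ x) hd.neg H₁ (u + V u + W u) (by
      intro d hdd
      have := hle u _ (H₁.add_mem (hV u) hdd)
      rw [show (u : H) + V u + W u + d = u + (V u + d) + W u by abel, ← hval]
      linarith) d hdd
    rw [hfn] at this
    simpa using this
  -- the continuity estimate
  have hest : ∀ u u' : H₂, ‖V u' - V u‖ + ‖W u' - W u‖ ≤
      4 / γ * ‖fderiv ℝ Φ (u' + V u + W u) - fderiv ℝ Φ (u + V u + W u)‖ := by
    intro u u'
    set E := fderiv ℝ Φ (u' + V u + W u) - fderiv ℝ Φ (u + V u + W u) with hE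
    have ha : V u' - V u ∈ H₁ := H₁.sub_mem (hV u') (hV u)
    have hb : W u' - W u ∈ H₃ := H₃.sub_mem (hW u') (hW u)
    have ea : fderiv ℝ Φ (u' + V u + W u) (V u' - V u) = E (V u' - V u) := by
      simp only [hE, _root_.sub_apply, hcr₁ u _ ha, sub_zero]
    have eb : fderiv ℝ Φ (u' + V u + W u) (W u' - W u) = E (W u' - W u) := by
      simp only [hE, _root_.sub_apply, hcr₃ u _ hb, sub_zero]
    have i1 := hq₁ (u' + V u + W u) _ ha
    rw [hfn, _root_.neg_apply, ea,
      show (u' : H) + V u + W u + (V u' - V u) = u' + V u' + W u by abel] at i1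
    have i2 := hq₃ (u' + V u + W u) _ hb
    rw [eb, show (u' : H) + V u + W u + (W u' - W u) = u' + V u + W u' by abel] at i2
    have i3 := hle u' _ (hV u)
    have i4 := hge u' _ (hW u)
    have i5 := le_of_abs_le (E.le_opNorm (V u' - V u))
    have i6 := (abs_le.1 ((Real.norm_eq_abs _).symm.le.trans (E.le_opNorm (W u' - W u)))).1
    set A := ‖V u' - V u‖
    set B := ‖W u' - W u‖
    have hA : 0 ≤ A := norm_nonneg _
    have hB : 0 ≤ B := norm_nonneg _
    have k1 : γ / 2 * (A ^ 2 + B ^ 2) ≤ ‖E‖ * (A + B) := by linarith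
    have k2 : γ * (A + B) * (A + B) ≤ 4 * ‖E‖ * (A + B) := by
      nlinarith [mul_nonneg hγ.le (sq_nonneg (A - B))]
    rcases (add_nonneg hA hB).eq_or_lt with h0 | h0
    · rw [← h0]; positivity
    · have := le_of_mul_le_mul_right k2 h0
      rw [div_mul_eq_mul_div, le_div_iff₀ hγ]
      linarith
  have hcd : Continuous (fderiv ℝ Φ) := hΦ.continuous_fderiv one_ne_zero
  have hlim : ∀ u : H₂, Tendsto (fun u' => ‖V u' - V u‖ + ‖W u' - W u‖) (𝓝 u) (𝓝 0) := by
    intro u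
    have h1 : Continuous fun u' : H₂ =>
        4 / γ * ‖fderiv ℝ Φ (u' + V u + W u) - fderiv ℝ Φ (u + V u + W u)‖ := by
      fun_prop
    have h2 := h1.tendsto u
    simp only [sub_self, norm_zero, mul_zero] at h2
    exact squeeze_zero (fun _ => by positivity) (hest u) h2
  have hVc : ∀ u : H₂, Tendsto V (𝓝 u) (𝓝 (V u)) := fun u =>
    tendsto_iff_norm_sub_tendsto_zero.2
      (squeeze_zero (fun _ => norm_nonneg _) (fun _ => le_add_of_nonneg_right (norm_nonneg _))
        (hlim u))
  have hWc : ∀ u : H₂, Tendsto W (𝓝 u) (𝓝 (W u)) := fun u =>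
    tendsto_iff_norm_sub_tendsto_zero.2
      (squeeze_zero (fun _ => norm_nonneg _) (fun _ => le_add_of_nonneg_left (norm_nonneg _))
        (hlim u))
  have hder : ∀ u : H₂,
      HasFDerivAt Φhat ((fderiv ℝ Φ (u + V u + W u)).comp H₂.subtypeL) u := by
    intro u
    have hs : HasStrictFDerivAt Φ (fderiv ℝ Φ (u + V u + W u)) (u + V u + W u) :=
      hΦ.contDiffAt.hasStrictFDerivAt one_ne_zero
    have hs' := hs.isLittleO
    have hid : Tendsto (fun u' : H₂ => (u' : H)) (𝓝 u) (𝓝 (u : H)) :=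
      continuous_subtype_val.tendsto u
    have t1 : Tendsto (fun u' : H₂ => ((u' + V u' + W u : H), (u + V u' + W u : H))) (𝓝 u)
        (𝓝 ((u + V u + W u : H), (u + V u + W u : H))) :=
      ((hid.add (hVc u)).add_const _).prodMk_nhds (((hVc u).const_add _).add_const _)
    have t2 : Tendsto (fun u' : H₂ => ((u' + V u + W u' : H), (u + V u + W u' : H))) (𝓝 u)
        (𝓝 ((u + V u + W u : H), (u + V u + W u : H))) :=
      ((hid.add_const _).add (hWc u)).prodMk_nhds ((hWc u).const_add _)
    rw [hasFDerivAt_iff_isLittleO, Asymptotics.isLittleO_iff]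
    intro ε hε
    have b1 := t1.eventually ((Asymptotics.isLittleO_iff.1 hs') hε)
    have b2 := t2.eventually ((Asymptotics.isLittleO_iff.1 hs') hε)
    filter_upwards [b1, b2] with u' c1 c2
    rw [show (u' : H) + V u' + W u - (u + V u' + W u) = ((u' - u : H₂) : H) by push_cast; abel,
      Real.norm_eq_abs, abs_le] at c1
    rw [show (u' : H) + V u + W u' - (u + V u + W u') = ((u' - u : H₂) : H) by push_cast; abel,
      Real.norm_eq_abs, abs_le] at c2
    have j1 := hge u' _ (hW u)
    have j2 := hle u _ (hV u')
    have j3 := hle u' _ (hV u)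
    have j4 := hge u _ (hW u')
    rw [Real.norm_eq_abs, abs_le]
    rw [Submodule.norm_coe] at c1 c2
    simp only [ContinuousLinearMap.comp_apply, Submodule.subtypeL_apply]
    constructor <;> linarith [c1.1, c1.2, c2.1, c2.2]
  have : CompleteSpace H₂ := hc₂.completeSpace_coe
  have hproj : ∀ v ∈ H₁, ∀ u : H₂, ∀ w ∈ H₃, H₂.orthogonalProjectionOnto (v + u + w) = u := by
    intro v hv u w hw
    have h1 : H₂.orthogonalProjectionOnto v = 0 :=
      Submodule.orthogonalProjectionOnto_eq_zero_iff.2 (ho₁₂ hv)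
    have h2 : H₂.orthogonalProjectionOnto w = 0 :=
      Submodule.orthogonalProjectionOnto_eq_zero_iff.2 (ho₂₃.symm hw)
    rw [map_add, map_add, h1, h2, zero_add, add_zero]
    exact Submodule.orthogonalProjectionOnto_mem_subspace_eq_self u
  have hfd : ∀ u : H₂, fderiv ℝ Φ (u + V u + W u) =
      (fderiv ℝ Φhat u).comp H₂.orthogonalProjectionOnto := by
    intro u
    ext y
    obtain ⟨v, hv, z, hz, w, hw, rfl⟩ := hdec y
    rw [(hder u).fderiv, ContinuousLinearMap.comp_apply, hproj v hv ⟨z, hz⟩ w hw, map_add, map_add,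
      hcr₁ u v hv, hcr₃ u w hw]
    simp
  intro x hx hx'
  obtain ⟨φ, hφ, y, hy⟩ := hPS (fun n => x n + V (x n) + W (x n))
    (by simpa only [← hval] using hx)
    (by
      simp only [hfd]
      have h1 : Continuous fun L : H₂ →L[ℝ] ℝ => L.comp H₂.orthogonalProjectionOnto := by fun_prop
      have h2 := (h1.tendsto 0).comp hx'
      simpa [Function.comp_def] using h2)
  refine ⟨φ, hφ, H₂.orthogonalProjectionOnto y, ?_⟩
  have h3 := ((H₂.orthogonalProjectionOnto).continuous.tendsto y).comp hy
  refine h3.congr fun n => ?_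
  have := hproj _ (hV (x (φ n))) (x (φ n)) _ (hW (x (φ n)))
  rw [add_comm (V (x (φ n)))] at this
  exact this
end

section
/- Let ι be a countable index type, λ : ι → ℝ, and let μ, β, β⁻, δ be real numbers with 0 < μ < β⁻ < β and δ > 0, such that |λ_i − μ| ≥ δ for every i ∈ ι, and λ_i ≤ β⁻ for every i with μ < λ_i < β. Set γ₁ = min{1, β/β⁻ − 1}, so γ₁ > 0. Then for every a : ι → ℝ such that a_i = 0 whenever λ_i ≥ β and the family (|λ_i − μ|·a_i²)_{i ∈ ι} is summable, the family ((λ_i − μ − β)·a_i²)_{i ∈ ι} is summable and Σ_{i ∈ ι} (λ_i − μ − β)·a_i² ≤ −γ₁ · Σ_{i ∈ ι} |λ_i − μ|·a_i². -/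
/-- Fourier-coefficient form of the estimate `⟨(L - μ - β)u, u⟩ ≤ -γ₁‖u‖²_E` on `E₁ ⊕ E₂`:
if `0 < μ < β⁻ < β`, `|λ_i - μ| ≥ δ > 0` for all `i`, `λ_i ≤ β⁻` whenever `μ < λ_i < β`,
and `γ₁ = min{1, β/β⁻ - 1}` (so `γ₁ > 0`), then for every `a : ι → ℝ` with `a_i = 0`
whenever `λ_i ≥ β` and `(|λ_i - μ|·a_i²)` summable, the family `((λ_i - μ - β)·a_i²)` is
summable and `Σ (λ_i - μ - β)·a_i² ≤ -γ₁·Σ |λ_i - μ|·a_i²`. -/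
theorem stmt_10 {ι : Type*} [Countable ι] (lam : ι → ℝ) (μ β βm δ : ℝ)
    (hμ : 0 < μ) (hμβm : μ < βm) (hβmβ : βm < β) (hδ : 0 < δ)
    (hgap : ∀ i, δ ≤ |lam i - μ|)
    (hmid : ∀ i, μ < lam i → lam i < β → lam i ≤ βm) :
    0 < min 1 (β / βm - 1) ∧
    ∀ a : ι → ℝ, (∀ i, β ≤ lam i → a i = 0) →
      Summable (fun i => |lam i - μ| * a i ^ 2) →
      Summable (fun i => (lam i - μ - β) * a i ^ 2) ∧
      ∑' i, (lam i - μ - β) * a i ^ 2 ≤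
        -(min 1 (β / βm - 1)) * ∑' i, |lam i - μ| * a i ^ 2 := by
  have hβm : 0 < βm := hμ.trans hμβm
  have h1 : 1 < β / βm := (one_lt_div hβm).2 hβmβ
  have hpos : 0 < min 1 (β / βm - 1) := lt_min one_pos (by linarith)
  refine ⟨hpos, fun a ha hs => ?_⟩
  have hsq : Summable (fun i => a i ^ 2) := by
    refine Summable.of_nonneg_of_le (fun i => sq_nonneg _) (fun i => ?_) (hs.mul_left δ⁻¹)
    rw [← mul_assoc]
    refine le_mul_of_one_le_left (sq_nonneg _) ?_
    rw [inv_mul_eq_div]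
    exact (one_le_div hδ).2 (hgap i)
  have hlin : Summable (fun i => (lam i - μ) * a i ^ 2) := by
    refine Summable.of_norm_bounded hs (fun i => ?_)
    rw [Real.norm_eq_abs, abs_mul, abs_of_nonneg (sq_nonneg (a i))]
  have hsum : Summable (fun i => (lam i - μ - β) * a i ^ 2) :=
    (hlin.sub (hsq.mul_left β)).congr (fun i => by ring)
  refine ⟨hsum, ?_⟩
  rw [← tsum_mul_left]
  refine hsum.tsum_le_tsum (fun i => ?_) (hs.mul_left _)
  rcases le_or_gt β (lam i) with h | h
  · simp [ha i h]
  rw [← mul_assoc]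
  refine mul_le_mul_of_nonneg_right ?_ (sq_nonneg _)
  have hg1 : min 1 (β / βm - 1) ≤ 1 := min_le_left _ _
  have hg2 : min 1 (β / βm - 1) ≤ β / βm - 1 := min_le_right _ _
  generalize min 1 (β / βm - 1) = g at *
  rcases le_or_gt (lam i) μ with h' | h'
  · rw [abs_of_nonpos (by linarith)]
    nlinarith
  · rw [abs_of_pos (by linarith)]
    have hm := hmid i h' h
    have e : β / βm * βm = β := div_mul_cancel₀ _ hβm.ne'
    have : (1 + g) * (lam i - μ) ≤ β / βm * βm :=
      mul_le_mul (by linarith) (by linarith) (by linarith) (by linarith)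
    nlinarith
end
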